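/- Let ω ⊂ ℝ² be open and bounded, let θ : ℝ → ℝ be twice continuously differentiable with θ'(s) = 0 for all s ≤ θ_m, let p > θ_m, let χ₁ : ℝ² → ℝ be smooth, and let φ be a smooth real-valued function compactly supported in the open set (−∞,p)×ω. Then 2 ∫_{(θ_m,p)×ω} θ'(s) · φ · (∂_τχ₁)(t) · χ₁(t) · ∂_sφ ds dt = ∫_{(θ_m,p)×ω} θ''(s) · χ₁(t)² · φ · ∂_τφ ds dt. -/

import Mathlib

open MeasureTheory Real Set

/-- The Hardy weight `ρ` centred at `p`. -/
noncomputable def rho (p : ℝ) (s : ℝ) : ℝ := if s ≤ p then 1 / (1 + (s - p) ^ 2) else 0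

/-- Longitudinal derivative `∂_s ψ` at `x = (s, t₂, t₃)`. -/
noncomputable def dS (ψ : ℝ × ℝ × ℝ → ℝ) (x : ℝ × ℝ × ℝ) : ℝ :=
  deriv (fun u => ψ (u, x.2)) x.1

/-- Transverse derivative `∂_{t₂} ψ`. -/
noncomputable def dT2 (ψ : ℝ × ℝ × ℝ → ℝ) (x : ℝ × ℝ × ℝ) : ℝ :=
  deriv (fun u => ψ (x.1, u, x.2.2)) x.2.1

/-- Transverse derivative `∂_{t₃} ψ`. -/
noncomputable def dT3 (ψ : ℝ × ℝ × ℝ → ℝ) (x : ℝ × ℝ × ℝ) : ℝ :=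
  deriv (fun u => ψ (x.1, x.2.1, u)) x.2.2

/-- `|∇'ψ|²`, the squared transverse gradient. -/
noncomputable def gradTsq (ψ : ℝ × ℝ × ℝ → ℝ) (x : ℝ × ℝ × ℝ) : ℝ :=
  (dT2 ψ x) ^ 2 + (dT3 ψ x) ^ 2

/-- The angular derivative `∂_τ ψ = t₂ ∂_{t₃} ψ − t₃ ∂_{t₂} ψ`. -/
noncomputable def dTau (ψ : ℝ × ℝ × ℝ → ℝ) (x : ℝ × ℝ × ℝ) : ℝ :=
  x.2.1 * dT3 ψ x - x.2.2 * dT2 ψ x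

/-- `∂_{t₂} v` for a function on the cross-section. -/
noncomputable def dV2 (v : ℝ × ℝ → ℝ) (t : ℝ × ℝ) : ℝ :=
  deriv (fun u => v (u, t.2)) t.1

/-- `∂_{t₃} v` for a function on the cross-section. -/
noncomputable def dV3 (v : ℝ × ℝ → ℝ) (t : ℝ × ℝ) : ℝ :=
  deriv (fun u => v (t.1, u)) t.2

/-- `|∇v|²` for a function on the cross-section. -/
noncomputable def gradVsq (v : ℝ × ℝ → ℝ) (t : ℝ × ℝ) : ℝ :=
  (dV2 v t) ^ 2 + (dV3 v t) ^ 2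

/-- Angular derivative on the cross-section. -/
noncomputable def dTauV (v : ℝ × ℝ → ℝ) (t : ℝ × ℝ) : ℝ :=
  t.1 * dV3 v t - t.2 * dV2 v t

/-- `v ∈ C_c^∞(ω)`. -/
def TestFun (ω : Set (ℝ × ℝ)) (v : ℝ × ℝ → ℝ) : Prop :=
  ContDiff ℝ (⊤ : ℕ∞) v ∧ HasCompactSupport v ∧ tsupport v ⊆ ω

/-- Admissible functions on `Ω₀ = ℝ × ω`: continuously differentiable on the closure of
`Ω₀`, square-integrable together with the first partial derivatives, and vanishing on the
Dirichlet part of the boundary, i.e. at `t ∈ ∂ω` for `s ∉ (a, a+l)`. -/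
def Admissible (ω : Set (ℝ × ℝ)) (a l : ℝ) (ψ : ℝ × ℝ × ℝ → ℝ) : Prop :=
  ContDiffOn ℝ 1 ψ ((Set.univ : Set ℝ) ×ˢ closure ω) ∧
  IntegrableOn (fun x => (ψ x) ^ 2) ((Set.univ : Set ℝ) ×ˢ ω) ∧
  IntegrableOn (fun x => (dS ψ x) ^ 2) ((Set.univ : Set ℝ) ×ˢ ω) ∧
  IntegrableOn (fun x => (dT2 ψ x) ^ 2) ((Set.univ : Set ℝ) ×ˢ ω) ∧
  IntegrableOn (fun x => (dT3 ψ x) ^ 2) ((Set.univ : Set ℝ) ×ˢ ω) ∧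
  ∀ s t, t ∈ frontier ω → s ∉ Set.Ioo a (a + l) → ψ (s, t) = 0

/-- The potential `g`: zero on the window interval, `E₁` elsewhere. -/
noncomputable def gpot (E₁ a l : ℝ) (s : ℝ) : ℝ := if s ∈ Set.Ioo a (a + l) then 0 else E₁

theorem HasDerivAt.hasLineDerivAt_fst {f : ℝ × ℝ × ℝ → ℝ} {f' : ℝ} {x : ℝ × ℝ × ℝ}
    (h : HasDerivAt (fun u => f (u, x.2)) f' x.1) : HasLineDerivAt ℝ f f' x (1, 0, 0) := by
  have h' : HasDerivAt (fun u => f (u, x.2)) f' (x.1 + 0) := by simpa using h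
  refine (h'.comp_const_add x.1 0).congr_of_eventuallyEq (.of_forall fun t =>
    congrArg f ?_)
  ext <;> simp

theorem HasDerivAt.hasLineDerivAt_snd_fst {f : ℝ × ℝ × ℝ → ℝ} {f' : ℝ} {x : ℝ × ℝ × ℝ}
    (h : HasDerivAt (fun u => f (x.1, u, x.2.2)) f' x.2.1) :
    HasLineDerivAt ℝ f f' x (0, 1, 0) := by
  have h' : HasDerivAt (fun u => f (x.1, u, x.2.2)) f' (x.2.1 + 0) := by simpa using h
  refine (h'.comp_const_add x.2.1 0).congr_of_eventuallyEq (.of_forall fun t =>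
    congrArg f ?_)
  ext <;> simp

theorem HasDerivAt.hasLineDerivAt_snd_snd {f : ℝ × ℝ × ℝ → ℝ} {f' : ℝ} {x : ℝ × ℝ × ℝ}
    (h : HasDerivAt (fun u => f (x.1, x.2.1, u)) f' x.2.2) :
    HasLineDerivAt ℝ f f' x (0, 0, 1) := by
  have h' : HasDerivAt (fun u => f (x.1, x.2.1, u)) f' (x.2.2 + 0) := by simpa using h
  refine (h'.comp_const_add x.2.2 0).congr_of_eventuallyEq (.of_forall fun t =>
    congrArg f ?_)
  ext <;> simp

theorem hasDerivAt_dS {ψ : ℝ × ℝ × ℝ → ℝ} (hψ : Differentiable ℝ ψ) (x : ℝ × ℝ × ℝ) :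
    HasDerivAt (fun u => ψ (u, x.2)) (dS ψ x) x.1 :=
  DifferentiableAt.hasDerivAt (by fun_prop)

theorem hasDerivAt_dT2 {ψ : ℝ × ℝ × ℝ → ℝ} (hψ : Differentiable ℝ ψ) (x : ℝ × ℝ × ℝ) :
    HasDerivAt (fun u => ψ (x.1, u, x.2.2)) (dT2 ψ x) x.2.1 :=
  DifferentiableAt.hasDerivAt (by fun_prop)

theorem hasDerivAt_dT3 {ψ : ℝ × ℝ × ℝ → ℝ} (hψ : Differentiable ℝ ψ) (x : ℝ × ℝ × ℝ) :
    HasDerivAt (fun u => ψ (x.1, x.2.1, u)) (dT3 ψ x) x.2.2 :=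
  DifferentiableAt.hasDerivAt (by fun_prop)

theorem hasDerivAt_dV2 {v : ℝ × ℝ → ℝ} (hv : Differentiable ℝ v) (t : ℝ × ℝ) :
    HasDerivAt (fun u => v (u, t.2)) (dV2 v t) t.1 :=
  DifferentiableAt.hasDerivAt (by fun_prop)

theorem hasDerivAt_dV3 {v : ℝ × ℝ → ℝ} (hv : Differentiable ℝ v) (t : ℝ × ℝ) :
    HasDerivAt (fun u => v (t.1, u)) (dV3 v t) t.2 :=
  DifferentiableAt.hasDerivAt (by fun_prop)

/-- A line derivative of a `C¹` function, given pointwise, is continuous. -/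
theorem ContDiff.continuous_of_hasLineDerivAt {E : Type*} [NormedAddCommGroup E]
    [NormedSpace ℝ E] {f f' : E → ℝ} {v : E} (hf : ContDiff ℝ 1 f)
    (h : ∀ x, HasLineDerivAt ℝ f (f' x) x v) : Continuous f' := by
  have : f' = fun x => fderiv ℝ f x v := funext fun x =>
    (h x).unique ((hf.differentiable one_ne_zero x).hasFDerivAt.hasLineDerivAt v)
  rw [this]
  exact (hf.continuous_fderiv one_ne_zero).clm_apply continuous_const

theorem ContDiff.continuous_dS {ψ : ℝ × ℝ × ℝ → ℝ} (hψ : ContDiff ℝ 1 ψ) :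
    Continuous (dS ψ) :=
  hψ.continuous_of_hasLineDerivAt fun x =>
    (hasDerivAt_dS (hψ.differentiable one_ne_zero) x).hasLineDerivAt_fst

theorem ContDiff.continuous_dT2 {ψ : ℝ × ℝ × ℝ → ℝ} (hψ : ContDiff ℝ 1 ψ) :
    Continuous (dT2 ψ) :=
  hψ.continuous_of_hasLineDerivAt fun x =>
    (hasDerivAt_dT2 (hψ.differentiable one_ne_zero) x).hasLineDerivAt_snd_fst

theorem ContDiff.continuous_dT3 {ψ : ℝ × ℝ × ℝ → ℝ} (hψ : ContDiff ℝ 1 ψ) :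
    Continuous (dT3 ψ) :=
  hψ.continuous_of_hasLineDerivAt fun x =>
    (hasDerivAt_dT3 (hψ.differentiable one_ne_zero) x).hasLineDerivAt_snd_snd

theorem ContDiff.continuous_dV2 {v : ℝ × ℝ → ℝ} (hv : ContDiff ℝ 1 v) :
    Continuous (dV2 v) := by
  have h : Continuous (dT2 fun x : ℝ × ℝ × ℝ => v x.2) :=
    (hv.comp contDiff_snd).continuous_dT2
  exact h.comp (Continuous.prodMk_right (0 : ℝ))

theorem ContDiff.continuous_dV3 {v : ℝ × ℝ → ℝ} (hv : ContDiff ℝ 1 v) :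
    Continuous (dV3 v) := by
  have h : Continuous (dT3 fun x : ℝ × ℝ × ℝ => v x.2) :=
    (hv.comp contDiff_snd).continuous_dT3
  exact h.comp (Continuous.prodMk_right (0 : ℝ))

/-- Integration by parts against products `φ * g` with `φ` compactly supported. -/
theorem integral_mul_hasLineDerivAt_eq_neg {φ f f' g g' : ℝ × ℝ × ℝ → ℝ} {v : ℝ × ℝ × ℝ}
    (hφ : Continuous φ) (hφc : HasCompactSupport φ) (hf : Continuous f) (hf' : Continuous f')
    (hg : Continuous g) (hg' : Continuous g') (hdf : ∀ x, HasLineDerivAt ℝ f (f' x) x v)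
    (hdg : ∀ x, HasLineDerivAt ℝ (fun x => φ x * g x) (φ x * g' x) x v) :
    ∫ x, f x * (φ x * g' x) = -∫ x, f' x * (φ x * g x) := by
  have hint : ∀ {a b : ℝ × ℝ × ℝ → ℝ}, Continuous a → Continuous b →
      Integrable fun x => a x * (φ x * b x) := fun ha hb =>
    (ha.mul (hφ.mul hb)).integrable_of_hasCompactSupport hφc.mul_right.mul_left
  have : (volume : Measure (ℝ × ℝ)).IsAddHaarMeasure :=
    Measure.prod.instIsAddHaarMeasure volume volume
  have : (volume : Measure (ℝ × ℝ × ℝ)).IsAddHaarMeasure :=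
    Measure.prod.instIsAddHaarMeasure volume volume
  exact integral_bilinear_hasLineDerivAt_right_eq_neg_left_of_integrable
    (B := ContinuousLinearMap.mul ℝ ℝ) (hint hf' hg) (hint hf hg') (hint hf hg)
    (fun x _ => hdf x) (fun x _ => hdg x)

/-- A differentiable function vanishing on `(-∞, a]` has vanishing derivative there. -/
theorem deriv_eq_zero_of_forall_le {f : ℝ → ℝ} {a : ℝ} (hf : Differentiable ℝ f)
    (h : ∀ s ≤ a, f s = 0) {s : ℝ} (hs : s ≤ a) : deriv f s = 0 := by
  have h₁ : HasDerivWithinAt f (deriv f s) (Iic s) s := (hf s).hasDerivAt.hasDerivWithinAt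
  have h₂ : HasDerivWithinAt f 0 (Iic s) s :=
    (hasDerivWithinAt_const s (Iic s) (0 : ℝ)).congr (fun u hu => h u (le_trans hu hs)) (h s hs)
  exact (uniqueDiffWithinAt_Iic s).eq_deriv _ h₁ h₂

theorem stmt_13 (ω : Set (ℝ × ℝ)) (hω_open : IsOpen ω) (hω_bdd : Bornology.IsBounded ω)
    (θ : ℝ → ℝ) (hθ : ContDiff ℝ 2 θ)
    (θm : ℝ) (hθ' : ∀ s ≤ θm, deriv θ s = 0)
    (p : ℝ) (hp : θm < p)
    (χ₁ : ℝ × ℝ → ℝ) (hχ₁ : ContDiff ℝ (⊤ : ℕ∞) χ₁)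
    (φ : ℝ × ℝ × ℝ → ℝ) (hφ : ContDiff ℝ (⊤ : ℕ∞) φ) (hφc : HasCompactSupport φ)
    (hφsupp : tsupport φ ⊆ Set.Iio p ×ˢ ω) :
    2 * (∫ x in Set.Ioo θm p ×ˢ ω,
        deriv θ x.1 * φ x * dTauV χ₁ x.2 * χ₁ x.2 * dS φ x)
      = ∫ x in Set.Ioo θm p ×ˢ ω,
          deriv (deriv θ) x.1 * (χ₁ x.2) ^ 2 * φ x * dTau φ x := by
  have hφ1 : ContDiff ℝ 1 φ := hφ.of_le (by exact_mod_cast le_top)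
  have hχ1 : ContDiff ℝ 1 χ₁ := hχ₁.of_le (by exact_mod_cast le_top)
  have hφd := hφ1.differentiable one_ne_zero
  have hχd := hχ1.differentiable one_ne_zero
  have hθ1 : ContDiff ℝ 1 (deriv θ) :=
    (contDiff_succ_iff_deriv (n := 1).mp (by simpa [one_add_one_eq_two] using hθ)).2.2
  have hθd := hθ1.differentiable one_ne_zero
  have cθ : Continuous (deriv θ) := hθ1.continuous
  have cθ' : Continuous (deriv (deriv θ)) := hθ1.continuous_deriv le_rfl
  have cφ := hφ1.continuous
  have cχ := hχ1.continuous
  have cS := hφ1.continuous_dS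
  have c2 := hφ1.continuous_dT2
  have c3 := hφ1.continuous_dT3
  have cV2 := hχ1.continuous_dV2
  have cV3 := hχ1.continuous_dV3
  have cV : Continuous (dTauV χ₁) := by unfold dTauV; fun_prop
  have cT : Continuous (dTau φ) := by unfold dTau; fun_prop
  have hout : ∀ x : ℝ × ℝ × ℝ, x ∉ Ioo θm p ×ˢ ω → x.1 ≤ θm ∨ φ x = 0 := by
    intro x hx
    refine (le_or_gt x.1 θm).imp_right fun h => image_eq_zero_of_notMem_tsupport fun hm => hx ?_
    exact ⟨⟨h, (hφsupp hm).1⟩, (hφsupp hm).2⟩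
  rw [setIntegral_eq_integral_of_forall_compl_eq_zero,
    setIntegral_eq_integral_of_forall_compl_eq_zero]
  rotate_left
  · intro x hx
    rcases hout x hx with h | h
    · simp [deriv_eq_zero_of_forall_le hθd hθ' h]
    · simp [h]
  · intro x hx
    rcases hout x hx with h | h
    · simp [hθ' _ h]
    · simp [h]
  have hs := integral_mul_hasLineDerivAt_eq_neg (v := (1, 0, 0)) (f := fun x => deriv θ x.1)
    (f' := fun x => deriv (deriv θ) x.1) (g := fun x => φ x * (χ₁ x.2 * dTauV χ₁ x.2))
    (g' := fun x => 2 * dS φ x * (χ₁ x.2 * dTauV χ₁ x.2)) cφ hφc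
    (by fun_prop) (by fun_prop) (by fun_prop) (by fun_prop)
    (fun x => (hθd x.1).hasDerivAt.hasLineDerivAt_fst)
    (fun x => by
      refine HasDerivAt.hasLineDerivAt_fst ?_
      have h := hasDerivAt_dS hφd x
      refine (h.mul (h.mul_const (χ₁ x.2 * dTauV χ₁ x.2))).congr_deriv ?_
      ring)
  have h2 := integral_mul_hasLineDerivAt_eq_neg (v := (0, 1, 0))
    (f := fun x => deriv (deriv θ) x.1 * x.2.2) (f' := fun _ => 0)
    (g := fun x => φ x * χ₁ x.2 ^ 2)
    (g' := fun x => 2 * (dT2 φ x * χ₁ x.2 ^ 2 + φ x * χ₁ x.2 * dV2 χ₁ x.2)) cφ hφc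
    (by fun_prop) (by fun_prop) (by fun_prop) (by fun_prop)
    (fun x => (hasDerivAt_const x.2.1 (deriv (deriv θ) x.1 * x.2.2)).hasLineDerivAt_snd_fst)
    (fun x => by
      refine HasDerivAt.hasLineDerivAt_snd_fst ?_
      have h := hasDerivAt_dT2 hφd x
      refine (h.mul (h.mul ((hasDerivAt_dV2 hχd x.2).pow 2))).congr_deriv ?_
      simp
      ring)
  have h3 := integral_mul_hasLineDerivAt_eq_neg (v := (0, 0, 1))
    (f := fun x => deriv (deriv θ) x.1 * x.2.1) (f' := fun _ => 0)
    (g := fun x => φ x * χ₁ x.2 ^ 2)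
    (g' := fun x => 2 * (dT3 φ x * χ₁ x.2 ^ 2 + φ x * χ₁ x.2 * dV3 χ₁ x.2)) cφ hφc
    (by fun_prop) (by fun_prop) (by fun_prop) (by fun_prop)
    (fun x => (hasDerivAt_const x.2.2 (deriv (deriv θ) x.1 * x.2.1)).hasLineDerivAt_snd_snd)
    (fun x => by
      refine HasDerivAt.hasLineDerivAt_snd_snd ?_
      have h := hasDerivAt_dT3 hφd x
      refine (h.mul (h.mul ((hasDerivAt_dV3 hχd x.2).pow 2))).congr_deriv ?_
      simp
      ring)
  have hint : ∀ {a b : ℝ × ℝ × ℝ → ℝ}, Continuous a → Continuous b →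
      Integrable fun x => a x * (φ x * b x) := fun ha hb =>
    (ha.mul (cφ.mul hb)).integrable_of_hasCompactSupport hφc.mul_right.mul_left
  simp only [zero_mul, integral_zero, neg_zero] at h2 h3
  have hτ := integral_sub
    (hint (a := fun x => deriv (deriv θ) x.1 * x.2.1)
      (b := fun x => 2 * (dT3 φ x * χ₁ x.2 ^ 2 + φ x * χ₁ x.2 * dV3 χ₁ x.2))
      (by fun_prop) (by fun_prop))
    (hint (a := fun x => deriv (deriv θ) x.1 * x.2.2)
      (b := fun x => 2 * (dT2 φ x * χ₁ x.2 ^ 2 + φ x * χ₁ x.2 * dV2 χ₁ x.2))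
      (by fun_prop) (by fun_prop))
  have hadd := integral_add
    (hint (a := fun x => deriv (deriv θ) x.1) (b := fun x => χ₁ x.2 ^ 2 * dTau φ x)
      (by fun_prop) (by fun_prop))
    (hint (a := fun x => deriv (deriv θ) x.1) (b := fun x => φ x * (χ₁ x.2 * dTauV χ₁ x.2))
      (by fun_prop) (by fun_prop))
  have hsum : ∀ x : ℝ × ℝ × ℝ,
      deriv (deriv θ) x.1 * x.2.1 *
          (φ x * (2 * (dT3 φ x * χ₁ x.2 ^ 2 + φ x * χ₁ x.2 * dV3 χ₁ x.2))) -
        deriv (deriv θ) x.1 * x.2.2 *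
          (φ x * (2 * (dT2 φ x * χ₁ x.2 ^ 2 + φ x * χ₁ x.2 * dV2 χ₁ x.2))) =
      2 * (deriv (deriv θ) x.1 * (φ x * (χ₁ x.2 ^ 2 * dTau φ x)) +
        deriv (deriv θ) x.1 * (φ x * (φ x * (χ₁ x.2 * dTauV χ₁ x.2)))) := by
    intro x
    simp only [dTau, dTauV]
    ring
  simp only [hsum] at hτ
  rw [integral_const_mul, hadd, h2, h3] at hτ
  have hl : 2 * ∫ x : ℝ × ℝ × ℝ, deriv θ x.1 * φ x * dTauV χ₁ x.2 * χ₁ x.2 * dS φ x =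
      ∫ x : ℝ × ℝ × ℝ, deriv θ x.1 * (φ x * (2 * dS φ x * (χ₁ x.2 * dTauV χ₁ x.2))) := by
    rw [← integral_const_mul]
    congr 1 with x
    ring
  have hr : ∫ x : ℝ × ℝ × ℝ, deriv (deriv θ) x.1 * χ₁ x.2 ^ 2 * φ x * dTau φ x =
      ∫ x : ℝ × ℝ × ℝ, deriv (deriv θ) x.1 * (φ x * (χ₁ x.2 ^ 2 * dTau φ x)) := by
    congr 1 with x
    ring
  rw [hl, hr, hs]
  linarith
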